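/- Let ε > 0, 0 < μ ≤ 12, let u be a classical 1-periodic solution of the quasi-linear surface wave equation on [0,T) such that ∫₀¹ (u(x,t)² + (μ/12)·u_x(x,t)²) dx = C₀ for every t ∈ [0,T), and set S(t) = sup_{x∈ℝ} u_x(x,t). Then for almost every t ∈ (0,T), |S'(t) − (7/4)·ε·S(t)²| ≤ (12/μ)·K₁, where K₁ = [2·n₂·C₀^{1/2} + (5/2)·ε·n_∞·C₀ + (1/8)·ε²·n_∞·√(13/μ)·C₀^{3/2} + (3/64)·ε³·n_∞·(13/μ)·C₀² + (7/4)·ε·n_∞·C₀] + [2·√(13/μ)·C₀^{1/2} + (5/2)·ε·(13/μ)·C₀ + (1/8)·ε²·(13/μ)^{3/2}·C₀^{3/2} + (3/64)·ε³·(13/μ)²·C₀²], with n₂ = ‖P‖_{L²[0,1]} and n_∞ = ‖P‖_{L^∞[0,1]}. -/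

import Mathlib

/-- The 1-periodic Green's function of the operator `1 - (μ/12)∂ₓ²`. -/
noncomputable def P (μ x : ℝ) : ℝ :=
  Real.sqrt (3/μ) *
    (Real.exp (2 * Real.sqrt (3/μ) * (x - ⌊x⌋)) +
     Real.exp (2 * Real.sqrt (3/μ) * (1 - (x - ⌊x⌋)))) /
  (Real.exp (2 * Real.sqrt (3/μ)) - 1)

/-- Periodic convolution with the kernel `P` over one period. -/
noncomputable def pconv (μ : ℝ) (h : ℝ → ℝ) (x : ℝ) : ℝ :=
  ∫ y in (0:ℝ)..1, P μ (x - y) * h y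

/-- The nonlinearity `g(w) = 2w + (5/2)εw² - (1/8)ε²w³ + (3/64)ε³w⁴ - (7/48)εμ(wₓ)²`,
with the derivative `w'` supplied explicitly. -/
noncomputable def gfun (ε μ : ℝ) (w w' : ℝ → ℝ) (x : ℝ) : ℝ :=
  2 * w x + (5/2) * ε * (w x)^2 - (1/8) * ε^2 * (w x)^3 + (3/64) * ε^3 * (w x)^4
    - (7/48) * ε * μ * (w' x)^2

/-- A classical 1-periodic solution of the quasi-linear surface wave equation
`u_t - u_x - (7/2)ε u u_x + ∂ₓ(P∗g(u)) = 0` on `ℝ × [0,T)`, recorded together with the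
partial derivatives `u_x`, `u_{xx}`, `u_t`, `u_{tx}`. -/
structure QLSol (ε μ T : ℝ) where
  u : ℝ → ℝ → ℝ
  ux : ℝ → ℝ → ℝ
  uxx : ℝ → ℝ → ℝ
  ut : ℝ → ℝ → ℝ
  utx : ℝ → ℝ → ℝ
  periodic : ∀ t ∈ Set.Ico (0:ℝ) T, Function.Periodic (fun x => u x t) 1
  hux : ∀ (x : ℝ), ∀ t ∈ Set.Ico (0:ℝ) T, HasDerivAt (fun x' => u x' t) (ux x t) x
  huxx : ∀ (x : ℝ), ∀ t ∈ Set.Ico (0:ℝ) T, HasDerivAt (fun x' => ux x' t) (uxx x t) x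
  hut : ∀ (x : ℝ), ∀ t ∈ Set.Ico (0:ℝ) T,
    HasDerivWithinAt (fun t' => u x t') (ut x t) (Set.Ico (0:ℝ) T) t
  hutx : ∀ (x : ℝ), ∀ t ∈ Set.Ico (0:ℝ) T,
    HasDerivWithinAt (fun t' => ux x t') (utx x t) (Set.Ico (0:ℝ) T) t
  contu : ContinuousOn (fun p : ℝ × ℝ => u p.1 p.2) (Set.univ ×ˢ Set.Ico (0:ℝ) T)
  contux : ContinuousOn (fun p : ℝ × ℝ => ux p.1 p.2) (Set.univ ×ˢ Set.Ico (0:ℝ) T)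
  contuxx : ContinuousOn (fun p : ℝ × ℝ => uxx p.1 p.2) (Set.univ ×ˢ Set.Ico (0:ℝ) T)
  contut : ContinuousOn (fun p : ℝ × ℝ => ut p.1 p.2) (Set.univ ×ˢ Set.Ico (0:ℝ) T)
  contutx : ContinuousOn (fun p : ℝ × ℝ => utx p.1 p.2) (Set.univ ×ˢ Set.Ico (0:ℝ) T)
  eqn : ∀ (x : ℝ), ∀ t ∈ Set.Ico (0:ℝ) T,
    ut x t - ux x t - (7/2) * ε * u x t * ux x t
      + deriv (pconv μ (gfun ε μ (fun x' => u x' t) (fun x' => ux x' t))) x = 0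

/-- `n₂ = ‖P‖_{L²[0,1]}`. -/
noncomputable def n2 (μ : ℝ) : ℝ := Real.sqrt (∫ x in (0:ℝ)..1, (P μ x)^2)

/-- `n_∞ = ‖P‖_{L^∞[0,1]}`. -/
noncomputable def ninf (μ : ℝ) : ℝ := sSup ((fun x => |P μ x|) '' Set.Icc (0:ℝ) 1)

/-- The constant `K₁` appearing in the differential inequalities for the maximal slope. -/
noncomputable def K1 (ε μ C₀ : ℝ) : ℝ :=
  (2 * n2 μ * Real.sqrt C₀ + (5/2) * ε * ninf μ * C₀
    + (1/8) * ε^2 * ninf μ * Real.sqrt (13/μ) * (C₀ * Real.sqrt C₀)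
    + (3/64) * ε^3 * ninf μ * (13/μ) * C₀^2
    + (7/4) * ε * ninf μ * C₀)
  + (2 * Real.sqrt (13/μ) * Real.sqrt C₀ + (5/2) * ε * (13/μ) * C₀
    + (1/8) * ε^2 * ((13/μ) * Real.sqrt (13/μ)) * (C₀ * Real.sqrt C₀)
    + (3/64) * ε^3 * (13/μ)^2 * C₀^2)

open Set MeasureTheory Filter Topology intervalIntegral

lemma exp_sub_one_pos_of_pos {k : ℝ} (hk : 0 < k) : 0 < Real.exp k - 1 := by
  have := Real.add_one_lt_exp hk.ne'
  linarith

lemma P_periodic (μ : ℝ) : Function.Periodic (P μ) 1 := by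
  intro x
  simp only [P, Int.floor_add_one, Int.cast_add, Int.cast_one, add_sub_add_right_eq_sub]

lemma P_eq_of_mem_Ico {μ x : ℝ} (hx : x ∈ Ico (0:ℝ) 1) :
    P μ x = Real.sqrt (3/μ) * (Real.exp (2 * Real.sqrt (3/μ) * x) +
      Real.exp (2 * Real.sqrt (3/μ) * (1 - x))) / (Real.exp (2 * Real.sqrt (3/μ)) - 1) := by
  have h0 : ⌊x⌋ = 0 := Int.floor_eq_zero_iff.2 hx
  simp [P, h0]

lemma P_nonneg {μ : ℝ} (hμ : 0 < μ) (x : ℝ) : 0 ≤ P μ x := by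
  have hk : 0 < 2 * Real.sqrt (3/μ) := by positivity
  have := exp_sub_one_pos_of_pos hk
  unfold P
  positivity

lemma P_measurable (μ : ℝ) : Measurable (P μ) := by
  unfold P
  fun_prop

lemma P_bddAbove {μ : ℝ} (hμ : 0 < μ) :
    BddAbove ((fun x => |P μ x|) '' Icc (0:ℝ) 1) := by
  have hk : 0 < 2 * Real.sqrt (3/μ) := by positivity
  have hk1 := exp_sub_one_pos_of_pos hk
  refine ⟨Real.sqrt (3/μ) * (Real.exp (2 * Real.sqrt (3/μ)) + Real.exp (2 * Real.sqrt (3/μ))) /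
    (Real.exp (2 * Real.sqrt (3/μ)) - 1), ?_⟩
  rintro _ ⟨x, -, rfl⟩
  simp only [abs_of_nonneg (P_nonneg hμ x)]
  unfold P
  have h1 := Int.fract_nonneg x
  have h2 := (Int.fract_lt_one x).le
  rw [Int.fract] at h1 h2
  have e1 : 2 * Real.sqrt (3/μ) * (x - ⌊x⌋) ≤ 2 * Real.sqrt (3/μ) := by nlinarith
  have e2 : 2 * Real.sqrt (3/μ) * (1 - (x - ⌊x⌋)) ≤ 2 * Real.sqrt (3/μ) := by nlinarith
  gcongr

lemma P_le_ninf {μ : ℝ} (hμ : 0 < μ) (x : ℝ) : P μ x ≤ ninf μ := by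
  have h : P μ (Int.fract x) = P μ x := by
    simpa only [Int.fract, mul_one] using (P_periodic μ).sub_int_mul_eq (x := x) ⌊x⌋
  rw [← h]
  exact (le_abs_self _).trans
    (le_csSup (P_bddAbove hμ) ⟨_, ⟨Int.fract_nonneg x, (Int.fract_lt_one x).le⟩, rfl⟩)

lemma ninf_nonneg {μ : ℝ} (hμ : 0 < μ) : 0 ≤ ninf μ := (P_nonneg hμ 0).trans (P_le_ninf hμ 0)

lemma P_sub_mul_intervalIntegrable {μ : ℝ} (hμ : 0 < μ) {h : ℝ → ℝ} (hh : Continuous h)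
    (x a b : ℝ) : IntervalIntegrable (fun y => P μ (x - y) * h y) volume a b := by
  have h1 : IntervalIntegrable (fun y => P μ (x - y)) volume a b := by
    refine (intervalIntegrable_const (c := ninf μ)).mono_fun
      ((P_measurable μ).comp (measurable_const.sub measurable_id)).aestronglyMeasurable
      (ae_of_all _ fun y => ?_)
    simp only [Real.norm_eq_abs, abs_of_nonneg (P_nonneg hμ _), abs_of_nonneg (ninf_nonneg hμ)]
    exact P_le_ninf hμ _
  exact h1.mul_continuousOn hh.continuousOn

lemma integral_P_sub_sq (μ x : ℝ) :
    ∫ y in (0:ℝ)..1, (P μ (x - y))^2 = ∫ y in (0:ℝ)..1, (P μ y)^2 := by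
  have hper : Function.Periodic (fun y => (P μ y)^2) 1 := fun y => by simp [P_periodic μ y]
  rw [integral_comp_sub_left (fun y => (P μ y)^2) x]
  have := hper.intervalIntegral_add_eq (x - 1) 0
  simpa using this

/-- The Cauchy–Schwarz inequality for interval integrals of real functions. -/
lemma abs_intervalIntegral_mul_le {f g : ℝ → ℝ} {a b : ℝ} (hab : a ≤ b)
    (hf : IntervalIntegrable (fun x => f x ^ 2) volume a b)
    (hg : IntervalIntegrable (fun x => g x ^ 2) volume a b)
    (hfg : IntervalIntegrable (fun x => f x * g x) volume a b) :
    |∫ x in a..b, f x * g x| ≤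
      Real.sqrt (∫ x in a..b, f x ^ 2) * Real.sqrt (∫ x in a..b, g x ^ 2) := by
  have hd : discrim (∫ x in a..b, f x ^ 2) (2 * ∫ x in a..b, f x * g x)
      (∫ x in a..b, g x ^ 2) ≤ 0 := by
    refine discrim_le_zero fun s => ?_
    have h : (∫ x in a..b, f x ^ 2) * (s * s) + (2 * ∫ x in a..b, f x * g x) * s
        + (∫ x in a..b, g x ^ 2) = ∫ x in a..b, (s * f x + g x) ^ 2 := by
      have e : ∀ x, (s * f x + g x) ^ 2 = (s * s) * f x ^ 2 + (2 * s) * (f x * g x) + g x ^ 2 :=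
        fun x => by ring
      simp only [e]
      rw [integral_add ((hf.const_mul _).add (hfg.const_mul _)) hg,
        integral_add (hf.const_mul _) (hfg.const_mul _), intervalIntegral.integral_const_mul, intervalIntegral.integral_const_mul]
      ring
    rw [h]
    exact integral_nonneg hab fun x _ => sq_nonneg _
  rw [← Real.sqrt_mul (integral_nonneg hab fun x _ => sq_nonneg _)]
  refine Real.abs_le_sqrt ?_
  unfold discrim at hd
  linarith

lemma pconv_eq {μ : ℝ} {h : ℝ → ℝ} (hper : Function.Periodic h 1) (hh : Continuous h) (x : ℝ) :
    pconv μ h x = Real.sqrt (3/μ) / (Real.exp (2 * Real.sqrt (3/μ)) - 1) *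
      (Real.exp (2 * Real.sqrt (3/μ) * x) *
          (∫ y in (x-1)..x, Real.exp (-(2 * Real.sqrt (3/μ) * y)) * h y) +
        Real.exp (2 * Real.sqrt (3/μ) * (1 - x)) *
          ∫ y in (x-1)..x, Real.exp (2 * Real.sqrt (3/μ) * y) * h y) := by
  have hp : Function.Periodic (fun y => P μ (x - y) * h y) 1 := fun y => by
    have : P μ (x - (y + 1)) = P μ (x - y) := by
      rw [← (P_periodic μ) (x - (y + 1))]; ring_nf
    simp only [this, hper y]
  have h1 := hp.intervalIntegral_add_eq 0 (x - 1)
  simp only [zero_add, sub_add_cancel] at h1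
  unfold pconv
  rw [h1, ← intervalIntegral.integral_const_mul, ← intervalIntegral.integral_const_mul, ← intervalIntegral.integral_add, ← intervalIntegral.integral_const_mul]
  · refine integral_congr_ae ?_
    have hne : ∀ᵐ y : ℝ, y ≠ x - 1 := by simp [ae_iff]
    filter_upwards [hne] with y hy hmem
    rw [uIoc_of_le (by linarith)] at hmem
    rw [P_eq_of_mem_Ico ⟨by linarith [hmem.2], by linarith [hmem.1]⟩,
      show 2 * Real.sqrt (3/μ) * (x - y) =
        2 * Real.sqrt (3/μ) * x + -(2 * Real.sqrt (3/μ) * y) by ring,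
      show 2 * Real.sqrt (3/μ) * (1 - (x - y)) =
        2 * Real.sqrt (3/μ) * (1 - x) + 2 * Real.sqrt (3/μ) * y by ring,
      Real.exp_add, Real.exp_add]
    ring
  all_goals exact Continuous.intervalIntegrable (by fun_prop) _ _

lemma hasDerivAt_integral_sub_one {f : ℝ → ℝ} (hf : Continuous f) (x : ℝ) :
    HasDerivAt (fun x => ∫ y in (x-1)..x, f y) (f x - f (x - 1)) x := by
  have hF : ∀ z, HasDerivAt (fun z => ∫ y in (0:ℝ)..z, f y) (f z) z := fun z =>
    (hf.integral_hasStrictDerivAt 0 z).hasDerivAt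
  have e : (fun x => ∫ y in (x-1)..x, f y) =
      fun x => (∫ y in (0:ℝ)..x, f y) - ∫ y in (0:ℝ)..(x-1), f y := by
    funext z
    rw [integral_interval_sub_left] <;> exact hf.intervalIntegrable _ _
  rw [e]
  exact (hF x).sub ((hF (x - 1)).comp_sub_const x 1)

/-- `P ∗ h` solves `(1 - (μ/12)∂ₓ²) (P ∗ h) = h`. -/
lemma pconv_hasDerivAt {μ : ℝ} (hμ : 0 < μ) {h : ℝ → ℝ} (hper : Function.Periodic h 1)
    (hh : Continuous h) (x : ℝ) :
    HasDerivAt (deriv (pconv μ h)) ((12/μ) * (pconv μ h x - h x)) x := by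
  set k := 2 * Real.sqrt (3/μ) with hk
  have hkpos : 0 < k := by positivity
  have hk2 : k * k = 12 / μ := by
    rw [hk, show 2 * Real.sqrt (3/μ) * (2 * Real.sqrt (3/μ)) =
      4 * (Real.sqrt (3/μ) * Real.sqrt (3/μ)) by ring, Real.mul_self_sqrt (by positivity)]
    ring
  have hD := exp_sub_one_pos_of_pos hkpos
  have hA : Real.sqrt (3/μ) = k / 2 := by rw [hk]; ring
  set A := Real.sqrt (3/μ) / (Real.exp k - 1) with hAdef
  have hAk : A * (Real.exp k - 1) = k / 2 := by rw [hAdef, hA]; field_simp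
  set I₁ : ℝ → ℝ := fun x => ∫ y in (x-1)..x, Real.exp (-(k * y)) * h y with hI₁
  set I₂ : ℝ → ℝ := fun x => ∫ y in (x-1)..x, Real.exp (k * y) * h y with hI₂
  have hp : pconv μ h =
      fun x => A * (Real.exp (k * x) * I₁ x + Real.exp (k * (1 - x)) * I₂ x) :=
    funext fun x => pconv_eq hper hh x
  have hsub : ∀ x, h (x - 1) = h x := fun x => by rw [← hper (x - 1)]; ring_nf
  have d₁ : ∀ x, HasDerivAt (fun x => Real.exp (k * x) * I₁ x)
      (k * (Real.exp (k * x) * I₁ x) + (1 - Real.exp k) * h x) x := fun x => by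
    have e1 : HasDerivAt (fun x => Real.exp (k * x)) (Real.exp (k * x) * (k * 1)) x :=
      ((hasDerivAt_id x).const_mul k).exp
    have := e1.mul (hasDerivAt_integral_sub_one
      (f := fun y => Real.exp (-(k * y)) * h y) (by fun_prop) x)
    refine this.congr_deriv ?_
    rw [hsub, show -(k * (x - 1)) = -(k * x) + k by ring, Real.exp_add, Real.exp_neg]
    simp only [hI₁]
    field_simp
  have d₂ : ∀ x, HasDerivAt (fun x => Real.exp (k * (1 - x)) * I₂ x)
      (-(k * (Real.exp (k * (1 - x)) * I₂ x)) + (Real.exp k - 1) * h x) x := fun x => by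
    have e1 : HasDerivAt (fun x => Real.exp (k * (1 - x)))
        (Real.exp (k * (1 - x)) * (k * (-1))) x :=
      (((hasDerivAt_id x).const_sub 1).const_mul k).exp
    have := e1.mul (hasDerivAt_integral_sub_one
      (f := fun y => Real.exp (k * y) * h y) (by fun_prop) x)
    refine this.congr_deriv ?_
    rw [hsub, show k * (1 - x) = k + -(k * x) by ring,
      show k * (x - 1) = k * x + -k by ring, Real.exp_add, Real.exp_add, Real.exp_neg,
      Real.exp_neg]
    simp only [hI₂]
    field_simp
  have hderiv : deriv (pconv μ h) =
      fun x => A * k * (Real.exp (k * x) * I₁ x - Real.exp (k * (1 - x)) * I₂ x) := by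
    funext z
    rw [hp]
    refine (((d₁ z).add (d₂ z)).const_mul A).deriv.trans ?_
    ring
  rw [hderiv]
  refine (((d₁ x).sub (d₂ x)).const_mul (A * k)).congr_deriv ?_
  rw [hp, ← hk2]
  linear_combination (-2 * k * h x) * hAk

/-- Sobolev inequality for 1-periodic functions with energy weight `μ/12 ≤ 1`. -/
lemma sq_le_energy {μ : ℝ} (hμ : 0 < μ) (hμ' : μ ≤ 12) {v v' : ℝ → ℝ}
    (hper : Function.Periodic v 1) (hv : ∀ x, HasDerivAt v (v' x) x) (hv' : Continuous v')
    (x₀ : ℝ) :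
    (v x₀)^2 ≤ (13/μ) * ∫ x in (0:ℝ)..1, ((v x)^2 + (μ/12) * (v' x)^2) := by
  have hvc : Continuous v := continuous_iff_continuousAt.2 fun x => (hv x).continuousAt
  have hper' : Function.Periodic v' 1 := fun x =>
    ((hv (x + 1)).comp_add_const x 1).unique (by rw [funext hper]; exact hv x)
  have hE : ∫ x in (0:ℝ)..1, ((v x)^2 + (μ/12) * (v' x)^2) =
      ∫ x in x₀..x₀+1, ((v x)^2 + (μ/12) * (v' x)^2) := by
    have hp : Function.Periodic (fun x => (v x)^2 + (μ/12) * (v' x)^2) 1 := fun x => by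
      simp only [hper x, hper' x]
    simpa using hp.intervalIntegral_add_eq 0 x₀
  set ψ : ℝ → ℝ := fun s => s - s^3/3 + s^5/9 with hψ
  set φ : ℝ → ℝ := fun x => (1 - (x - x₀ - 1/2)^2 + 5/9 * (x - x₀ - 1/2)^4) * (v x)^2
    + ψ (x - x₀ - 1/2) * (2 * v x * v' x) with hφ
  have hφc : Continuous φ := by simp only [hφ, hψ]; fun_prop
  have hd : ∀ x, HasDerivAt (fun x => ψ (x - x₀ - 1/2) * (v x)^2) (φ x) x := fun x => by
    have h1 : HasDerivAt (fun x : ℝ => x - x₀ - 1/2) 1 x :=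
      ((hasDerivAt_id x).sub_const x₀).sub_const (1/2)
    have := ((h1.sub ((h1.pow 3).div_const 3)).add ((h1.pow 5).div_const 9)).mul ((hv x).pow 2)
    refine this.congr_deriv ?_
    simp only [hφ, hψ, Pi.add_apply, Pi.sub_apply, Pi.pow_apply]
    push_cast
    ring
  have hI : ∫ x in x₀..x₀+1, φ x = 133/144 * (v x₀)^2 := by
    rw [integral_eq_sub_of_hasDerivAt (fun x _ => hd x) (hφc.intervalIntegrable _ _), hper x₀]
    simp only [hψ]
    ring
  have hle : ∫ x in x₀..x₀+1, (μ/12) * φ x ≤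
      ∫ x in x₀..x₀+1, ((v x)^2 + (μ/12) * (v' x)^2) := by
    refine integral_mono_on (by linarith) ((hφc.const_mul _).intervalIntegrable _ _)
      (Continuous.intervalIntegrable (by fun_prop) _ _) fun x hx => ?_
    set s := x - x₀ - 1/2 with hs
    have hs2 : s^2 ≤ 1/4 := by
      have h1 : -(1/2) ≤ s := by linarith [hx.1]
      have h2 : s ≤ 1/2 := by linarith [hx.2]
      nlinarith
    have hric : 1 - s^2 + 5/9 * s^4 + (ψ s)^2 ≤ 1 := by
      have e : 1 - s^2 + 5/9 * s^4 + (ψ s)^2 - 1 =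
          -(s^4 * ((1/9 - s^2/3) + s^4 * (2/27 - s^2/81))) := by
        simp only [hψ]; ring
      have : 0 ≤ s^4 * ((1/9 - s^2/3) + s^4 * (2/27 - s^2/81)) := by
        have a1 : 0 ≤ 1/9 - s^2/3 := by linarith
        have a2 : 0 ≤ 2/27 - s^2/81 := by linarith
        positivity
      linarith
    have h1 : φ x ≤ (v x)^2 + (v' x)^2 := by
      have : φ x = (1 - s^2 + 5/9 * s^4) * (v x)^2 + ψ s * (2 * v x * v' x) := rfl
      rw [this]
      nlinarith [sq_nonneg (ψ s * v x - v' x), mul_le_mul_of_nonneg_right hric (sq_nonneg (v x))]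
    have h2 : (μ/12) * φ x ≤ (μ/12) * ((v x)^2 + (v' x)^2) := by gcongr
    have h3 : (μ/12) * (v x)^2 ≤ 1 * (v x)^2 := by gcongr; linarith
    linarith
  rw [intervalIntegral.integral_const_mul, hI] at hle
  rw [hE, div_mul_eq_mul_div, le_div_iff₀ hμ]
  nlinarith [sq_nonneg (v x₀), mul_nonneg hμ.le (sq_nonneg (v x₀))]

namespace QLSol

variable {ε μ T : ℝ}

lemma continuous_slice {f : ℝ → ℝ → ℝ}
    (hf : ContinuousOn (fun p : ℝ × ℝ => f p.1 p.2) (univ ×ˢ Ico (0:ℝ) T)) {t : ℝ}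
    (ht : t ∈ Ico (0:ℝ) T) : Continuous fun x => f x t :=
  hf.comp_continuous (f := fun x : ℝ => (x, t)) (by fun_prop) fun _ => ⟨mem_univ _, ht⟩

lemma ux_periodic (sol : QLSol ε μ T) {t : ℝ} (ht : t ∈ Ico (0:ℝ) T) :
    Function.Periodic (fun x => sol.ux x t) 1 := fun x =>
  ((sol.hux (x + 1) t ht).comp_add_const x 1).unique
    (by rw [funext (sol.periodic t ht)]; exact sol.hux x t ht)

lemma hasDerivAt_ux (sol : QLSol ε μ T) (x : ℝ) {t : ℝ} (ht : t ∈ Ioo (0:ℝ) T) :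
    HasDerivAt (fun t' => sol.ux x t') (sol.utx x t) t :=
  (sol.hutx x t (Ioo_subset_Ico_self ht)).hasDerivAt (Ico_mem_nhds ht.1 ht.2)

lemma exists_bound_utx (sol : QLSol ε μ T) {a b : ℝ} (hab : Icc a b ⊆ Ico 0 T) {K : Set ℝ}
    (hK : IsCompact K) :
    ∃ L : ℝ, ∀ x ∈ K, ∀ t ∈ Icc a b, |sol.utx x t| ≤ L := by
  obtain ⟨L, hL⟩ := (hK.prod isCompact_Icc).exists_bound_of_continuousOn
    (sol.contutx.mono (prod_mono (subset_univ K) hab))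
  exact ⟨L, fun x hx t ht => hL (x, t) ⟨hx, ht⟩⟩

/-- The mixed partial derivatives of `u` commute. -/
lemma hasDerivAt_ut (sol : QLSol ε μ T) (x : ℝ) {t : ℝ} (ht : t ∈ Ioo (0:ℝ) T) :
    HasDerivAt (fun x' => sol.ut x' t) (sol.utx x t) x := by
  have ht' := Ioo_subset_Ico_self ht
  obtain ⟨a, ha0, hat⟩ := exists_between ht.1
  obtain ⟨b, hbt, hbT⟩ := exists_between ht.2
  have hab : Icc a b ⊆ Ioo 0 T := fun s hs => ⟨ha0.trans_le hs.1, hs.2.trans_lt hbT⟩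
  have hab' : Icc a b ⊆ Ico 0 T := hab.trans Ioo_subset_Ico_self
  have key : ∀ z, sol.ut z t - sol.ut 0 t = ∫ y in (0:ℝ)..z, sol.utx y t := fun z => by
    obtain ⟨L, hL⟩ := sol.exists_bound_utx hab' (isCompact_uIcc (a := (0:ℝ)) (b := z))
    have h1 := (hasDerivAt_integral_of_dominated_loc_of_deriv_le (μ := volume)
      (F := fun t' y => sol.ux y t') (F' := fun t' y => sol.utx y t') (x₀ := t)
      (a := 0) (b := z) (s := Icc a b) (bound := fun _ => L) (Icc_mem_nhds hat hbt)
      (by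
        filter_upwards [Icc_mem_nhds hat hbt] with s hs
        exact (continuous_slice sol.contux (hab' hs)).aestronglyMeasurable)
      ((continuous_slice sol.contux ht').intervalIntegrable _ _)
      (continuous_slice sol.contutx ht').aestronglyMeasurable
      (ae_of_all _ fun y hy s hs => hL y (uIoc_subset_uIcc hy) s hs)
      intervalIntegrable_const
      (ae_of_all _ fun y _ s hs => sol.hasDerivAt_ux y (hab hs))).2
    have h2 : HasDerivAt (fun t' => sol.u z t' - sol.u 0 t') (sol.ut z t - sol.ut 0 t) t :=
      ((sol.hut z t ht').sub (sol.hut 0 t ht')).hasDerivAt (Ico_mem_nhds ht.1 ht.2)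
    refine h2.unique (h1.congr_of_eventuallyEq ?_)
    filter_upwards [Ico_mem_nhds ht.1 ht.2] with s hs
    exact (integral_eq_sub_of_hasDerivAt (fun y _ => sol.hux y s hs)
      ((continuous_slice sol.contux hs).intervalIntegrable _ _)).symm
  have e : (fun x' => sol.ut x' t) = fun x' => sol.ut 0 t + ∫ y in (0:ℝ)..x', sol.utx y t :=
    funext fun z => by rw [← key z]; ring
  rw [e]
  exact ((continuous_slice sol.contutx ht').integral_hasStrictDerivAt 0 x).hasDerivAt.const_add _

/-- The equation differentiated in `x`. -/
lemma utx_eq (sol : QLSol ε μ T) (hμ : 0 < μ) (x : ℝ) {t : ℝ} (ht : t ∈ Ioo (0:ℝ) T) :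
    sol.utx x t = sol.uxx x t
      + (7/2) * ε * (sol.ux x t * sol.ux x t + sol.u x t * sol.uxx x t)
      - (12/μ) * (pconv μ (gfun ε μ (fun x' => sol.u x' t) (fun x' => sol.ux x' t)) x
        - gfun ε μ (fun x' => sol.u x' t) (fun x' => sol.ux x' t) x) := by
  have ht' := Ioo_subset_Ico_self ht
  have hc := continuous_slice sol.contu ht'
  have hc' := continuous_slice sol.contux ht'
  have hd := pconv_hasDerivAt hμ (h := gfun ε μ (fun x' => sol.u x' t) (fun x' => sol.ux x' t))
    (fun y => by
      have h1 := sol.periodic t ht' y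
      have h2 := sol.ux_periodic ht' y
      simp only [gfun] at h1 h2 ⊢
      rw [h1, h2])
    (by unfold gfun; fun_prop) x
  have hsum := ((sol.huxx x t ht').add
    (((sol.hux x t ht').mul (sol.huxx x t ht')).const_mul ((7/2) * ε))).sub hd
  refine (sol.hasDerivAt_ut x ht).unique (hsum.congr_of_eventuallyEq (.of_forall fun y => ?_))
  have := sol.eqn y t ht'
  simp only [Pi.sub_apply, Pi.add_apply, Pi.mul_apply]
  linarith

lemma exists_max_ux (sol : QLSol ε μ T) {t : ℝ} (ht : t ∈ Ico (0:ℝ) T) :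
    ∃ x₀, ∀ x, sol.ux x t ≤ sol.ux x₀ t := by
  obtain ⟨x₀, -, hx₀⟩ := (isCompact_Icc (a := (0:ℝ)) (b := 1)).exists_isMaxOn
    (nonempty_Icc.2 zero_le_one) (continuous_slice sol.contux ht).continuousOn
  refine ⟨x₀, fun x => ?_⟩
  obtain ⟨y, hy, hxy⟩ := (sol.ux_periodic ht).exists_mem_Ico₀ one_pos x
  exact hxy.le.trans <| hx₀ (Ico_subset_Icc_self hy)

lemma ux_le_sSup (sol : QLSol ε μ T) {t : ℝ} (ht : t ∈ Ico (0:ℝ) T) (x : ℝ) :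
    sol.ux x t ≤ sSup (range fun x => sol.ux x t) := by
  obtain ⟨x₀, hx₀⟩ := sol.exists_max_ux ht
  exact le_csSup ⟨_, forall_mem_range.2 hx₀⟩ (mem_range_self x)

lemma exists_lipschitzOnWith (sol : QLSol ε μ T) {a b : ℝ} (hab : Icc a b ⊆ Ioo 0 T) :
    ∃ K : NNReal, LipschitzOnWith K (fun t => sSup (range fun x => sol.ux x t)) (Icc a b) := by
  have hab' : Icc a b ⊆ Ico 0 T := hab.trans Ioo_subset_Ico_self
  obtain ⟨L, hL⟩ := sol.exists_bound_utx hab' (isCompact_Icc (a := (0:ℝ)) (b := 1))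
  refine ⟨L.toNNReal, LipschitzOnWith.of_le_add_mul _ fun s hs t ht => ?_⟩
  refine csSup_le (range_nonempty _) (forall_mem_range.2 fun x => ?_)
  have hper : Function.Periodic (fun x => (sol.ux x s, sol.ux x t)) 1 := fun x =>
    Prod.ext (sol.ux_periodic (hab' hs) x) (sol.ux_periodic (hab' ht) x)
  obtain ⟨y, hy, hxy⟩ := hper.exists_mem_Ico₀ one_pos x
  have hxy' : sol.ux x s = sol.ux y s := congrArg Prod.fst hxy
  rw [hxy']
  have h := (convex_Icc a b).norm_image_sub_le_of_norm_hasDerivWithin_le (C := L.toNNReal)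
    (fun r hr => (sol.hasDerivAt_ux y (hab hr)).hasDerivWithinAt)
    (fun r hr => (hL y (Ico_subset_Icc_self hy) r hr).trans (Real.le_coe_toNNReal L)) ht hs
  have h1 := (le_abs_self _).trans h
  have h2 := sol.ux_le_sSup (hab' ht) y
  rw [Real.dist_eq]
  rw [Real.norm_eq_abs] at h1
  linarith

lemma ae_differentiableAt_sSup (sol : QLSol ε μ T) :
    ∀ᵐ t, t ∈ Ioo (0:ℝ) T →
      DifferentiableAt ℝ (fun t => sSup (range fun x => sol.ux x t)) t := by
  have h : ∀ p q : ℚ, 0 < (p : ℝ) → (q : ℝ) < T → ∀ᵐ t : ℝ, t ∈ Icc (p : ℝ) q →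
      DifferentiableWithinAt ℝ (fun t => sSup (range fun x => sol.ux x t)) (Icc (p : ℝ) q) t := by
    intro p q hp hq
    obtain ⟨K, hK⟩ := sol.exists_lipschitzOnWith (a := p) (b := q)
      fun s hs => ⟨hp.trans_le hs.1, hs.2.trans_lt hq⟩
    exact hK.ae_differentiableWithinAt_of_mem
  have h' : ∀ p q : ℚ, ∀ᵐ t : ℝ, 0 < (p : ℝ) → (q : ℝ) < T → t ∈ Icc (p : ℝ) q →
      DifferentiableWithinAt ℝ (fun t => sSup (range fun x => sol.ux x t)) (Icc (p : ℝ) q) t :=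
    fun p q => eventually_imp_distrib_left.2 fun hp => eventually_imp_distrib_left.2 (h p q hp)
  filter_upwards [ae_all_iff.2 fun p => ae_all_iff.2 (h' p)] with t ht hmem
  obtain ⟨p, hp0, hpt⟩ := exists_rat_btwn hmem.1
  obtain ⟨q, htq, hqT⟩ := exists_rat_btwn hmem.2
  exact (ht p q hp0 hqT ⟨hpt.le, htq.le⟩).differentiableAt (Icc_mem_nhds hpt htq)

end QLSol

/-- Bound on the lower-order part of the nonlinearity. -/
lemma abs_gfun_sub_le {ε μ M : ℝ} (hε : 0 < ε) (hμ : 0 < μ) {v v' : ℝ → ℝ} {x : ℝ}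
    (hM : |v x| ≤ M) :
    |gfun ε μ v v' x - 2 * v x| ≤
      (5/2 * ε + 1/8 * ε^2 * M + 3/64 * ε^3 * M^2) * (v x)^2 + 7/48 * ε * μ * (v' x)^2 := by
  have h2 : (v x)^2 ≤ M^2 := sq_le_sq' (by linarith [neg_abs_le (v x)]) ((le_abs_self _).trans hM)
  have h3 : |(v x)^3| ≤ M * (v x)^2 := by
    rw [abs_pow, pow_succ', sq_abs]
    gcongr
  have h4 : (v x)^4 ≤ M^2 * (v x)^2 := by
    rw [show (v x)^4 = (v x)^2 * (v x)^2 by ring]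
    gcongr
  have a3 := mul_le_mul_of_nonneg_left (abs_le.1 h3).1 (by positivity : 0 ≤ 1/8 * ε^2)
  have b3 := mul_le_mul_of_nonneg_left (abs_le.1 h3).2 (by positivity : 0 ≤ 1/8 * ε^2)
  have b4 := mul_le_mul_of_nonneg_left h4 (by positivity : 0 ≤ 3/64 * ε^3)
  have p2 : 0 ≤ 5/2 * ε * (v x)^2 := by positivity
  have p4 : 0 ≤ 3/64 * ε^3 * (v x)^4 := by positivity
  have p5 : 0 ≤ 7/48 * ε * μ * (v' x)^2 := by positivity
  unfold gfun
  rw [abs_le]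
  constructor <;> linarith

/-- The lower-order part of the nonlinearity and its smoothed version are controlled by `K1`. -/
lemma abs_pconv_gfun_sub_le {ε μ C₀ : ℝ} (hε : 0 < ε) (hμ : 0 < μ) (hμ' : μ ≤ 12)
    {v v' : ℝ → ℝ} (hper : Function.Periodic v 1) (hv : ∀ x, HasDerivAt v (v' x) x)
    (hv' : Continuous v')
    (hC : (∫ x in (0:ℝ)..1, ((v x)^2 + (μ/12) * (v' x)^2)) = C₀) (x : ℝ) :
    |pconv μ (gfun ε μ v v') x - (gfun ε μ v v' x + 7/48 * ε * μ * (v' x)^2)| ≤ K1 ε μ C₀ := by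
  have hvc : Continuous v := continuous_iff_continuousAt.2 fun x => (hv x).continuousAt
  have hC0 : 0 ≤ C₀ := by
    rw [← hC]; exact integral_nonneg zero_le_one fun y _ => by positivity
  set r := Real.sqrt (13/μ) with hr
  set c := Real.sqrt C₀ with hc
  have hr2 : r^2 = 13/μ := Real.sq_sqrt (by positivity)
  have hc2 : c^2 = C₀ := Real.sq_sqrt hC0
  have hr0 : 0 ≤ r := Real.sqrt_nonneg _
  have hc0 : 0 ≤ c := Real.sqrt_nonneg _
  have hM : ∀ y, |v y| ≤ r * c := fun y => by
    refine abs_le_of_sq_le_sq ?_ (by positivity)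
    rw [mul_pow, hr2, hc2, ← hC]
    exact sq_le_energy hμ hμ' hper hv hv' y
  set α := 5/2 * ε + 1/8 * ε^2 * (r * c) + 3/64 * ε^3 * (r * c)^2 with hα
  have hα0 : 0 ≤ α := by positivity
  have hn0 := ninf_nonneg hμ
  have hloc : |gfun ε μ v v' x + 7/48 * ε * μ * (v' x)^2| ≤ 2 * (r * c) + α * (r * c)^2 := by
    have h1 := abs_gfun_sub_le (v' := fun _ => 0) hε hμ (hM x)
    have h2 : gfun ε μ v v' x + 7/48 * ε * μ * (v' x)^2 = gfun ε μ v (fun _ => 0) x := by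
      simp only [gfun]; ring
    have h3 : (v x)^2 ≤ (r * c)^2 := by
      rw [← sq_abs (v x)]; gcongr; exact hM x
    have h4 : α * (v x)^2 ≤ α * (r * c)^2 := by gcongr
    rw [h2]
    rw [← hα] at h1
    have h5 := hM x
    rw [abs_le] at h1 h5 ⊢
    constructor <;> linarith
  have hint : IntervalIntegrable (fun y => P μ (x - y) * v y) volume 0 1 :=
    P_sub_mul_intervalIntegrable hμ hvc x 0 1
  have hint' : IntervalIntegrable (fun y => P μ (x - y) * (gfun ε μ v v' y - 2 * v y)) volume 0 1 :=
    P_sub_mul_intervalIntegrable hμ (by unfold gfun; fun_prop) x 0 1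
  have hsplit : pconv μ (gfun ε μ v v') x = 2 * (∫ y in (0:ℝ)..1, P μ (x - y) * v y)
      + ∫ y in (0:ℝ)..1, P μ (x - y) * (gfun ε μ v v' y - 2 * v y) := by
    rw [← intervalIntegral.integral_const_mul, ← integral_add (hint.const_mul 2) hint']
    unfold pconv
    congr 1
    funext y
    ring
  have hlin : |∫ y in (0:ℝ)..1, P μ (x - y) * v y| ≤ n2 μ * c := by
    have hP2 : IntervalIntegrable (fun y => P μ (x - y) ^ 2) volume 0 1 := by
      refine (intervalIntegrable_const (c := ninf μ ^ 2)).mono_fun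
        (((P_measurable μ).comp (measurable_const.sub measurable_id)).pow_const
          2).aestronglyMeasurable (ae_of_all _ fun y => ?_)
      simp only [Real.norm_eq_abs, abs_pow, abs_of_nonneg (P_nonneg hμ _), abs_of_nonneg hn0]
      exact pow_le_pow_left₀ (P_nonneg hμ _) (P_le_ninf hμ _) 2
    refine (abs_intervalIntegral_mul_le zero_le_one hP2
      (Continuous.intervalIntegrable (by fun_prop) _ _) hint).trans ?_
    rw [integral_P_sub_sq]
    unfold n2
    gcongr
    rw [hc, ← hC]
    refine Real.sqrt_le_sqrt (integral_mono_on zero_le_one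
      (Continuous.intervalIntegrable (by fun_prop) _ _)
      (Continuous.intervalIntegrable (by fun_prop) _ _) fun y _ => ?_)
    have : 0 ≤ (μ/12) * (v' y)^2 := by positivity
    linarith
  have hrest : |∫ y in (0:ℝ)..1, P μ (x - y) * (gfun ε μ v v' y - 2 * v y)| ≤
      ninf μ * ((α + 7/4 * ε) * C₀) := by
    rw [← hC, ← intervalIntegral.integral_const_mul, ← intervalIntegral.integral_const_mul]
    refine (abs_integral_le_integral_abs zero_le_one).trans
      (integral_mono_on zero_le_one hint'.abs
        (Continuous.intervalIntegrable (by fun_prop) _ _) fun y _ => ?_)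
    rw [abs_mul, abs_of_nonneg (P_nonneg hμ _)]
    refine mul_le_mul (P_le_ninf hμ _) ((abs_gfun_sub_le hε hμ (hM y)).trans ?_)
      (abs_nonneg _) hn0
    rw [← hα]
    have h1 : 0 ≤ 7/4 * ε * (v y)^2 := by positivity
    have h2 : 0 ≤ α * ((μ/12) * (v' y)^2) := by positivity
    linarith
  have hK : K1 ε μ C₀ = 2 * (n2 μ * c) + ninf μ * ((α + 7/4 * ε) * C₀)
      + (2 * (r * c) + α * (r * c)^2) := by
    unfold K1
    rw [← hr, ← hc, hα, ← hr2, ← hc2]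
    ring
  rw [hK, hsplit]
  rw [abs_le] at *
  constructor <;> linarith

/-- Differential inequalities for the maximal slope: if the energy of the solution equals
`C₀` for every `t`, then for a.e. `t ∈ (0,T)`, `|S'(t) - (7/4)ε S(t)²| ≤ (12/μ)·K₁`. -/
theorem stmt12 (ε μ T C₀ : ℝ) (hε : 0 < ε) (hμ : 0 < μ) (hμ' : μ ≤ 12) (hT : 0 < T)
    (sol : QLSol ε μ T)
    (hC : ∀ t ∈ Set.Ico (0:ℝ) T,
      (∫ x in (0:ℝ)..1, ((sol.u x t)^2 + (μ/12) * (sol.ux x t)^2)) = C₀)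
    (S : ℝ → ℝ) (hS : ∀ t, S t = sSup (Set.range fun x => sol.ux x t)) :
    ∀ᵐ t ∂MeasureTheory.volume, t ∈ Set.Ioo (0:ℝ) T →
      DifferentiableAt ℝ S t ∧
      |deriv S t - (7/4) * ε * (S t)^2| ≤ (12/μ) * K1 ε μ C₀ := by
  have hS' : S = fun t => sSup (Set.range fun x => sol.ux x t) := funext hS
  filter_upwards [sol.ae_differentiableAt_sSup] with t hdiff ht
  have ht' := Ioo_subset_Ico_self ht
  have hd : DifferentiableAt ℝ S t := hS' ▸ hdiff ht
  refine ⟨hd, ?_⟩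
  obtain ⟨x₀, hx₀⟩ := sol.exists_max_ux ht'
  have hSt : S t = sol.ux x₀ t := by
    rw [hS]
    exact le_antisymm (csSup_le (range_nonempty _) (forall_mem_range.2 hx₀)) (sol.ux_le_sSup ht' x₀)
  have huxx : sol.uxx x₀ t = 0 :=
    IsLocalMax.hasDerivAt_eq_zero (f := fun x => sol.ux x t) (.of_forall hx₀) (sol.huxx x₀ t ht')
  have hmin : IsLocalMin (fun s => S s - sol.ux x₀ s) t := by
    filter_upwards [Ico_mem_nhds ht.1 ht.2] with s hs
    rw [hSt, sub_self, hS, sub_nonneg]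
    exact sol.ux_le_sSup hs x₀
  have hderiv : deriv S t = sol.utx x₀ t :=
    sub_eq_zero.1 (hmin.hasDerivAt_eq_zero (hd.hasDerivAt.sub (sol.hasDerivAt_ux x₀ ht)))
  have hbound := abs_pconv_gfun_sub_le hε hμ hμ' (sol.periodic t ht')
    (fun x => sol.hux x t ht') (QLSol.continuous_slice sol.contux ht') (hC t ht') x₀
  have heq : deriv S t - (7/4) * ε * (S t)^2 = -((12/μ) *
      (pconv μ (gfun ε μ (fun x' => sol.u x' t) (fun x' => sol.ux x' t)) x₀
        - (gfun ε μ (fun x' => sol.u x' t) (fun x' => sol.ux x' t) x₀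
          + 7/48 * ε * μ * (sol.ux x₀ t)^2))) := by
    rw [hderiv, hSt, sol.utx_eq hμ x₀ ht, huxx]
    field_simp
    ring
  rw [heq, abs_neg, abs_mul, abs_of_pos (by positivity : 0 < 12/μ)]
  gcongr
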